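/- arXiv:2306.09084 — 3 statements merged into one kernel-verified Lean document; each statement's English description precedes it below -/
import Mathlib

section
/- Let ζ > 0 and 0 < b ≤ ζ/(2+ζ), and suppose δ ∈ (0, ζ] satisfies ζ² − δ² = 4b² (cosh(δ/2) + (ζ/δ) sinh(δ/2))². Then J_B(b, ζ) = −2b² R, where R = 1 + sinh²(δ/2)·(1 + ζ(ζ−4)/δ²) − (2−ζ)·sinh(δ)/δ + (ζ/b²)·log(cosh(δ/2) + (ζ/δ) sinh(δ/2)) − ζ²/(2b²). -/
open MeasureTheory Real Filter

/-- The rate function `J_B(b, ζ)`: the infimum, over measurable `g : [0,1] → ℝ`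
with `∫₀¹ g(t)² dt < ∞`, of
`2b² ∫₀¹ exp(∫₀ᵗ g(s) ds) dt + (1/2) ∫₀¹ (g(t) − ζ)² dt`. -/
noncomputable def JB (b ζ : ℝ) : ℝ :=
  sInf {y : ℝ | ∃ g : ℝ → ℝ, Measurable g ∧
    IntegrableOn (fun t => (g t) ^ 2) (Set.Icc 0 1) ∧
    y = 2 * b ^ 2 * (∫ t in (0:ℝ)..1, Real.exp (∫ s in (0:ℝ)..t, g s)) +
        (1 / 2) * ∫ t in (0:ℝ)..1, (g t - ζ) ^ 2}

open Set in
lemma jb_ibp (e k : ℝ → ℝ) (he : IntervalIntegrable e volume 0 1)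
    (hk : IntervalIntegrable k volume 0 1) :
    ∫ t in (0:ℝ)..1, ((∫ s in (1:ℝ)..t, e s) * k t + e t * ∫ s in (0:ℝ)..t, k s) = 0 := by
  have h1 : (1:ℝ) ∈ uIcc (0:ℝ) 1 := by simp
  have h0 : (0:ℝ) ∈ uIcc (0:ℝ) 1 := by simp
  have A := he.absolutelyContinuousOnInterval_intervalIntegral h1
  have B := hk.absolutelyContinuousOnInterval_intervalIntegral h0
  have I := A.integral_deriv_mul_eq_sub B
  simp only [intervalIntegral.integral_same, zero_mul, mul_zero, sub_zero] at I
  refine Eq.trans ?_ I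
  apply intervalIntegral.integral_congr_ae
  filter_upwards [he.ae_hasDerivAt_integral, hk.ae_hasDerivAt_integral] with x hx hx' hm
  have hm' := uIoc_subset_uIcc hm
  rw [(hx hm' 1 h1).deriv, (hx' hm' 0 h0).deriv]
  ring

open Set in
lemma jb_abstract (b ζ δ : ℝ) (h p : ℝ → ℝ) (hpm : Measurable p)
    (hh : ∀ t ∈ Icc (0:ℝ) 1, HasDerivAt h (p t) t)
    (hp : ∀ t ∈ Icc (0:ℝ) 1, HasDerivAt p (2 * b ^ 2 * Real.exp (h t)) t)
    (hen : ∀ t ∈ Icc (0:ℝ) 1, p t ^ 2 = δ ^ 2 + 2 * (2 * b ^ 2 * Real.exp (h t)))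
    (h0 : h 0 = 0) (p1 : p 1 = ζ) :
    JB b ζ = 2 * (ζ - p 0) + δ ^ 2 / 2 - ζ * h 1 + ζ ^ 2 / 2 := by
  have huI : uIcc (0:ℝ) 1 = Icc 0 1 := uIcc_of_le zero_le_one
  have hhc : ContinuousOn h (Icc 0 1) := fun t ht => (hh t ht).continuousAt.continuousWithinAt
  have hpc : ContinuousOn p (Icc 0 1) := fun t ht => (hp t ht).continuousAt.continuousWithinAt
  have hec : ContinuousOn (fun t => 2 * b ^ 2 * Real.exp (h t)) (Icc 0 1) := by fun_prop
  have hii : ∀ f : ℝ → ℝ, ContinuousOn f (Icc 0 1) → IntervalIntegrable f volume 0 1 :=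
    fun f hf => ContinuousOn.intervalIntegrable (by rwa [huI])
  have hH : ∀ t ∈ Icc (0:ℝ) 1, ∫ s in (0:ℝ)..t, p s = h t := by
    intro t ht
    have hs : uIcc 0 t ⊆ Icc (0:ℝ) 1 := by
      rw [uIcc_of_le ht.1]; exact Icc_subset_Icc le_rfl ht.2
    rw [intervalIntegral.integral_eq_sub_of_hasDerivAt (fun x hx => hh x (hs hx))
      (ContinuousOn.intervalIntegrable (hpc.mono hs)), h0, sub_zero]
  have hQ : ∀ t ∈ Icc (0:ℝ) 1, ∫ s in (1:ℝ)..t, 2 * b ^ 2 * Real.exp (h s) = p t - ζ := by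
    intro t ht
    have hs : uIcc 1 t ⊆ Icc (0:ℝ) 1 := by
      rw [uIcc_of_ge ht.2]; exact Icc_subset_Icc ht.1 le_rfl
    rw [intervalIntegral.integral_eq_sub_of_hasDerivAt (fun x hx => hp x (hs hx))
      (ContinuousOn.intervalIntegrable (hec.mono hs)), p1]
  -- the value
  have hV : ∫ t in (0:ℝ)..1, (2 * b ^ 2 * Real.exp (h t) + (1 / 2) * (p t - ζ) ^ 2)
      = 2 * (ζ - p 0) + δ ^ 2 / 2 - ζ * h 1 + ζ ^ 2 / 2 := by
    rw [intervalIntegral.integral_eq_sub_of_hasDerivAt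
      (f := fun t => 2 * p t + (δ ^ 2 / 2 + ζ ^ 2 / 2) * t - ζ * h t)]
    · simp only [p1, h0]; ring
    · intro t ht
      rw [huI] at ht
      have := (((hp t ht).const_mul 2).add ((hasDerivAt_id t).const_mul
        (δ ^ 2 / 2 + ζ ^ 2 / 2))).sub ((hh t ht).const_mul ζ)
      refine this.congr_deriv ?_
      linear_combination (-1/2) * hen t ht
    · apply hii; fun_prop
  rw [← hV]
  have hmem : ∀ g : ℝ → ℝ, IntervalIntegrable (fun t => Real.exp (∫ s in (0:ℝ)..t, g s)) volume 0 1 →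
      IntervalIntegrable (fun t => (g t - ζ) ^ 2) volume 0 1 →
      2 * b ^ 2 * (∫ t in (0:ℝ)..1, Real.exp (∫ s in (0:ℝ)..t, g s)) +
        (1 / 2) * ∫ t in (0:ℝ)..1, (g t - ζ) ^ 2 =
      ∫ t in (0:ℝ)..1, (2 * b ^ 2 * Real.exp (∫ s in (0:ℝ)..t, g s) + (1/2) * (g t - ζ) ^ 2) := by
    intro g h1 h2
    rw [intervalIntegral.integral_add (h1.const_mul _) (h2.const_mul _),
      intervalIntegral.integral_const_mul, intervalIntegral.integral_const_mul]
  unfold JB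
  apply IsLeast.csInf_eq
  constructor
  · refine ⟨p, hpm, ?_, ?_⟩
    · exact (hpc.pow 2).integrableOn_Icc
    · have hE : ContinuousOn (fun t => Real.exp (∫ s in (0:ℝ)..t, p s)) (Icc 0 1) :=
        ContinuousOn.congr (f := fun t => Real.exp (h t)) (by fun_prop)
          (fun t ht => by simp only [hH t ht])
      rw [hmem p (hii _ hE) (hii _ (by fun_prop))]
      apply intervalIntegral.integral_congr
      intro t ht
      rw [huI] at ht
      simp only [hH t ht]
  · rintro y ⟨g, hgm, hg2, rfl⟩
    have hgL : MemLp g 2 (volume.restrict (Icc (0:ℝ) 1)) :=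
      (memLp_two_iff_integrable_sq hgm.aestronglyMeasurable).2 hg2
    have hgi : IntervalIntegrable g volume 0 1 := by
      rw [intervalIntegrable_iff_integrableOn_Icc_of_le zero_le_one]
      exact hgL.integrable one_le_two
    have hg2i : IntervalIntegrable (fun t => (g t) ^ 2) volume 0 1 := by
      rw [intervalIntegrable_iff_integrableOn_Icc_of_le zero_le_one]
      exact hg2
    have hgz : IntervalIntegrable (fun t => (g t - ζ) ^ 2) volume 0 1 := by
      have := (hg2i.sub (hgi.const_mul (2 * ζ))).add
        (intervalIntegrable_const (c := ζ ^ 2) : IntervalIntegrable _ volume 0 1)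
      refine this.congr (fun t _ => ?_)
      ring
    have hGc : ContinuousOn (fun t => ∫ s in (0:ℝ)..t, g s) (Icc 0 1) := by
      have := (hgi.absolutelyContinuousOnInterval_intervalIntegral
        (c := 0) (by simp)).continuousOn
      rwa [huI] at this
    have hpi := hii p hpc
    have hki : IntervalIntegrable (fun t => g t - p t) volume 0 1 := hgi.sub hpi
    have ibp := jb_ibp _ _ (hii _ hec) hki
    have hGe : IntervalIntegrable (fun t => Real.exp (∫ s in (0:ℝ)..t, g s)) volume 0 1 :=
      hii _ (by fun_prop)
    rw [hmem g hGe hgz]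
    have hZ : ∫ t in (0:ℝ)..1, ((p t - ζ) * (g t - p t) +
        2 * b ^ 2 * Real.exp (h t) * ((∫ s in (0:ℝ)..t, g s) - h t)) = 0 := by
      refine Eq.trans ?_ ibp
      apply intervalIntegral.integral_congr
      intro t ht
      rw [huI] at ht
      have hs : uIcc 0 t ⊆ uIcc (0:ℝ) 1 := by
        rw [uIcc_of_le ht.1, huI]; exact Icc_subset_Icc le_rfl ht.2
      simp only [hQ t ht]
      rw [intervalIntegral.integral_sub (hgi.mono_set hs) (hpi.mono_set hs), hH t ht]
    have hI1 : IntervalIntegrable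
        (fun t => 2 * b ^ 2 * Real.exp (h t) + (1 / 2) * (p t - ζ) ^ 2) volume 0 1 :=
      hii _ (by fun_prop)
    have hI2 : IntervalIntegrable (fun t => (p t - ζ) * (g t - p t) +
        2 * b ^ 2 * Real.exp (h t) * ((∫ s in (0:ℝ)..t, g s) - h t)) volume 0 1 := by
      refine IntervalIntegrable.add (hki.continuousOn_mul ?_) (hii _ (by fun_prop))
      rw [huI]; fun_prop
    have hsum := intervalIntegral.integral_add hI1 hI2
    rw [hZ, add_zero] at hsum
    rw [← hsum]
    apply intervalIntegral.integral_mono_on zero_le_one (hI1.add hI2)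
      ((hGe.const_mul _).add (hgz.const_mul _))
    intro t ht
    set G := ∫ s in (0:ℝ)..t, g s
    have e1 : Real.exp (h t) * (G - h t + 1) ≤ Real.exp G := by
      calc _ ≤ Real.exp (h t) * Real.exp (G - h t) :=
            mul_le_mul_of_nonneg_left (Real.add_one_le_exp _) (Real.exp_pos _).le
        _ = _ := by rw [← Real.exp_add]; congr 1; ring
    have e2 := mul_le_mul_of_nonneg_left e1 (show 0 ≤ 2 * b ^ 2 by positivity)
    nlinarith [sq_nonneg (g t - p t)]

/-- Case i) of Proposition 2: for `0 < b ≤ ζ/(2+ζ)` and `δ ∈ (0, ζ]` solving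
`ζ² − δ² = 4b² (cosh(δ/2) + (ζ/δ) sinh(δ/2))²`, the rate function is
`J_B(b,ζ) = −2b² R(b,ζ)` with `R` as below. -/
theorem JB_formula_case_i (b ζ δ : ℝ) (hζ : 0 < ζ) (hb : 0 < b)
    (hb' : b ≤ ζ / (2 + ζ)) (hδ : δ ∈ Set.Ioc 0 ζ)
    (heq : ζ ^ 2 - δ ^ 2 =
      4 * b ^ 2 * (Real.cosh (δ / 2) + (ζ / δ) * Real.sinh (δ / 2)) ^ 2) :
    JB b ζ = -2 * b ^ 2 *
      (1 + Real.sinh (δ / 2) ^ 2 * (1 + ζ * (ζ - 4) / δ ^ 2)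
        - (2 - ζ) * Real.sinh δ / δ
        + (ζ / b ^ 2) *
            Real.log (Real.cosh (δ / 2) + (ζ / δ) * Real.sinh (δ / 2))
        - ζ ^ 2 / (2 * b ^ 2)) := by
  obtain ⟨hδ0, hδζ⟩ := hδ
  set K := Real.cosh (δ / 2) with hK
  set S := Real.sinh (δ / 2) with hS
  set C := K + (ζ / δ) * S with hC
  have hS0 : 0 < S := Real.sinh_pos_iff.2 (by positivity)
  have hK0 : 0 < K := Real.cosh_pos _
  have hC0 : 0 < C := by positivity
  have hKS : K ^ 2 - S ^ 2 = 1 := Real.cosh_sq_sub_sinh_sq _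
  have hSd : Real.sinh δ = 2 * S * K := by
    rw [hS, hK, ← Real.sinh_two_mul]; congr 1; ring
  let w : ℝ → ℝ := fun t => Real.cosh (δ * (1 - t) / 2) + (ζ / δ) * Real.sinh (δ * (1 - t) / 2)
  let v : ℝ → ℝ := fun t => δ * Real.sinh (δ * (1 - t) / 2) + ζ * Real.cosh (δ * (1 - t) / 2)
  have hwpos : ∀ t ∈ Set.Icc (0:ℝ) 1, 0 < w t := by
    intro t ht
    have h1 : 0 ≤ Real.sinh (δ * (1 - t) / 2) := Real.sinh_nonneg_iff.2
      (by have := ht.2; have : 0 ≤ 1 - t := by linarith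
          positivity)
    have h2 := Real.cosh_pos (δ * (1 - t) / 2)
    positivity
  have hin : ∀ t : ℝ, HasDerivAt (fun t : ℝ => δ * (1 - t) / 2) (-(δ / 2)) t := by
    intro t
    have := (((hasDerivAt_id t).const_sub 1).const_mul δ).div_const 2
    refine this.congr_deriv ?_
    ring
  have hw : ∀ t, HasDerivAt w (-(v t) / 2) t := by
    intro t
    refine ((hin t).cosh.add ((hin t).sinh.const_mul (ζ / δ))).congr_deriv ?_
    simp only [v]; field_simp; ring
  have hv : ∀ t, HasDerivAt v (-(δ ^ 2 * w t) / 2) t := by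
    intro t
    refine (((hin t).sinh.const_mul δ).add ((hin t).cosh.const_mul ζ)).congr_deriv ?_
    simp only [w]; field_simp; ring
  have hcons : ∀ t, v t ^ 2 - δ ^ 2 * w t ^ 2 = 4 * b ^ 2 * C ^ 2 := by
    intro t
    rw [← heq]
    have := Real.cosh_sq_sub_sinh_sq (δ * (1 - t) / 2)
    have e : δ * w t = δ * Real.cosh (δ * (1 - t) / 2) + ζ * Real.sinh (δ * (1 - t) / 2) := by
      simp only [w]; field_simp
    rw [← mul_pow, e]
    simp only [v]
    linear_combination (ζ ^ 2 - δ ^ 2) * this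
  have hw0 : w 0 = C := by simp [w, hC, hK, hS]
  have hw1 : w 1 = 1 := by simp [w]
  have hv0 : v 0 = δ * S + ζ * K := by simp [v, hK, hS]
  have hv1 : v 1 = ζ := by simp [v]
  have hexp : ∀ t ∈ Set.Icc (0:ℝ) 1,
      Real.exp (2 * Real.log C - 2 * Real.log (w t)) = C ^ 2 / w t ^ 2 := by
    intro t ht
    have hp := hwpos t ht
    rw [Real.exp_sub, two_mul, two_mul, Real.exp_add, Real.exp_add, Real.exp_log hC0,
      Real.exp_log hp]
    ring
  have key := jb_abstract b ζ δ (fun t => 2 * Real.log C - 2 * Real.log (w t))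
    (fun t => v t / w t) (by
      have : Continuous v := by simp only [v]; fun_prop
      have : Continuous w := by simp only [w]; fun_prop
      fun_prop) ?_ ?_ ?_ ?_ ?_
  · rw [key]
    simp only [hw0, hw1, hv0, Real.log_one, hSd]
    have hx : ζ * C - δ * S - ζ * K = 4 * b ^ 2 * C ^ 2 * S / δ := by
      rw [← heq, hC]; field_simp; ring
    have hy : ζ - (δ * S + ζ * K) / C = 4 * b ^ 2 * C * S / δ := by
      have : ζ - (δ * S + ζ * K) / C = (ζ * C - δ * S - ζ * K) / C := by field_simp; ring
      rw [this, hx]; field_simp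
    have hz : C ^ 2 - 1 - S ^ 2 * (1 + ζ * (ζ - 4) / δ ^ 2) + (2 - ζ) * (2 * S * K) / δ
        = 4 * C * S / δ := by
      have : K ^ 2 = 1 + S ^ 2 := by linarith
      rw [hC]; field_simp; ring_nf; rw [this]; ring
    rw [hy]
    have hl : b ^ 2 * (ζ / b ^ 2 * Real.log C) = ζ * Real.log C := by field_simp
    have hl2 : b ^ 2 * (ζ ^ 2 / (2 * b ^ 2)) = ζ ^ 2 / 2 := by field_simp
    linear_combination (-1/2) * heq - 2 * b ^ 2 * hz + 2 * hl - 2 * hl2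
  · intro t ht
    have hp := hwpos t ht
    refine (((hw t).log hp.ne').const_mul 2).const_sub (2 * Real.log C) |>.congr_deriv ?_
    field_simp
  · intro t ht
    have hp := hwpos t ht
    refine ((hv t).div (hw t) hp.ne').congr_deriv ?_
    rw [hexp t ht]
    field_simp
    linear_combination hcons t
  · intro t ht
    have hp := hwpos t ht
    rw [hexp t ht]
    field_simp
    linear_combination hcons t
  · simp [hw0]
  · simp [hw1, hv1]
end

section
/- Let ζ ≥ 0 and b > 0 with b ≥ ζ/(2+ζ), and suppose ξ ∈ (0, π/2) satisfies 2ξ²(4ξ² + ζ²) = 2b² (2ξ cos ξ + ζ sin ξ)². Then J_B(b, ζ) = −2b² R, where R = 1 − sin²ξ · (1 + ζ(4−ζ)/(4ξ²)) + ((ζ−2)/(2ξ)) · sin(2ξ) + (ζ/b²) · log(cos ξ + ζ sin ξ/(2ξ)) − ζ²/(2b²). -/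
open MeasureTheory Real Filter

lemma JB_parts (p p' k : ℝ → ℝ)
    (hp : ∀ t ∈ Set.Icc (0:ℝ) 1, HasDerivAt p (p' t) t)
    (hp' : ContinuousOn p' (Set.Icc (0:ℝ) 1)) (h1 : p 1 = 0)
    (hk : IntervalIntegrable k volume 0 1) :
    ∫ t in (0:ℝ)..1, (p' t * (∫ s in (0:ℝ)..t, k s) + p t * k t) = 0 := by
  have hu : Set.uIcc (0:ℝ) 1 = Set.Icc 0 1 := Set.uIcc_of_le zero_le_one
  obtain ⟨C, hC⟩ := isCompact_Icc.exists_bound_of_continuousOn hp'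
  have hC0 : 0 ≤ C := (norm_nonneg _).trans (hC 0 (by simp))
  have hpac : AbsolutelyContinuousOnInterval p 0 1 := by
    apply LipschitzOnWith.absolutelyContinuousOnInterval (K := ⟨C, hC0⟩)
    rw [hu]
    apply (convex_Icc (0:ℝ) 1).lipschitzOnWith_of_nnnorm_hasDerivWithin_le
      (f' := p') (fun t ht => (hp t ht).hasDerivWithinAt)
    intro t ht
    exact hC t ht
  have hkac := hk.absolutelyContinuousOnInterval_intervalIntegral
    (c := 0) (by simp)
  have key := hpac.integral_deriv_mul_eq_sub hkac
  rw [h1] at key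
  simp only [intervalIntegral.integral_same, mul_zero, zero_mul, sub_zero] at key
  refine Eq.trans ?_ key
  apply intervalIntegral.integral_congr_ae
  filter_upwards [hk.ae_hasDerivAt_integral] with t ht ht'
  have ht2 : t ∈ Set.uIcc (0:ℝ) 1 := Set.uIoc_subset_uIcc ht'
  rw [(ht ht2 0 (by simp)).deriv, (hp t (hu ▸ ht2)).deriv]

lemma JB_eq (b ζ : ℝ) (h p : ℝ → ℝ) (hpm : Measurable p)
    (hh : ∀ t ∈ Set.Icc (0:ℝ) 1, HasDerivAt h (p t) t)
    (hp : ∀ t ∈ Set.Icc (0:ℝ) 1, HasDerivAt p (2 * b ^ 2 * Real.exp (h t)) t)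
    (h0 : h 0 = 0) (h1 : p 1 = ζ) :
    JB b ζ = ∫ t in (0:ℝ)..1, (2 * b ^ 2 * Real.exp (h t) + (1 / 2) * (p t - ζ) ^ 2) := by
  have hu : Set.uIcc (0:ℝ) 1 = Set.Icc 0 1 := Set.uIcc_of_le zero_le_one
  have hhc : ContinuousOn h (Set.uIcc (0:ℝ) 1) := fun t ht =>
    (hh t (hu ▸ ht)).continuousAt.continuousWithinAt
  have hpc : ContinuousOn p (Set.uIcc (0:ℝ) 1) := fun t ht =>
    (hp t (hu ▸ ht)).continuousAt.continuousWithinAt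
  have hpi : IntervalIntegrable p volume 0 1 := hpc.intervalIntegrable
  have hec : ContinuousOn (fun t => 2 * b ^ 2 * Real.exp (h t)) (Set.uIcc (0:ℝ) 1) := by fun_prop
  have hqc : ContinuousOn (fun t => (1 / 2) * (p t - ζ) ^ 2) (Set.uIcc (0:ℝ) 1) := by fun_prop
  have hint : ∀ t ∈ Set.Icc (0:ℝ) 1, ∫ s in (0:ℝ)..t, p s = h t := by
    intro t ht
    have hsub : Set.uIcc 0 t ⊆ Set.Icc (0:ℝ) 1 := by
      rw [Set.uIcc_of_le ht.1]; exact Set.Icc_subset_Icc le_rfl ht.2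
    rw [intervalIntegral.integral_eq_sub_of_hasDerivAt (f := h)
      (fun s hs => hh s (hsub hs)) (hpc.mono (hu ▸ hsub)).intervalIntegrable, h0, sub_zero]
  have hleast : IsLeast {y : ℝ | ∃ g : ℝ → ℝ, Measurable g ∧
    IntegrableOn (fun t => (g t) ^ 2) (Set.Icc 0 1) ∧
    y = 2 * b ^ 2 * (∫ t in (0:ℝ)..1, Real.exp (∫ s in (0:ℝ)..t, g s)) +
        (1 / 2) * ∫ t in (0:ℝ)..1, (g t - ζ) ^ 2}
      (∫ t in (0:ℝ)..1, (2 * b ^ 2 * Real.exp (h t) + (1 / 2) * (p t - ζ) ^ 2)) := by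
    constructor
    · refine ⟨p, hpm, ?_, ?_⟩
      · exact ((hu ▸ hpc).pow 2).integrableOn_Icc
      · rw [intervalIntegral.integral_add hec.intervalIntegrable hqc.intervalIntegrable,
          intervalIntegral.integral_const_mul, intervalIntegral.integral_const_mul]
        congr 2
        apply intervalIntegral.integral_congr
        intro t ht
        simp only [hint t (hu ▸ ht)]
    · rintro y ⟨g, hgm, hg2, rfl⟩
      have hg2' : IntervalIntegrable (fun t => (g t) ^ 2) volume 0 1 := by
        rw [intervalIntegrable_iff_integrableOn_Icc_of_le zero_le_one]; exact hg2
      have hgi : IntervalIntegrable g volume 0 1 := by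
        refine ((intervalIntegrable_const (c := (1:ℝ))).add hg2').mono_fun
          hgm.aestronglyMeasurable ?_
        refine Eventually.of_forall fun t => ?_
        simp only [Real.norm_eq_abs]
        rw [abs_of_nonneg (by positivity : 0 ≤ 1 + g t ^ 2), abs_le]
        constructor <;> nlinarith [sq_nonneg (g t - 1), sq_nonneg (g t + 1)]
      have hGc : ContinuousOn (fun t => ∫ s in (0:ℝ)..t, g s) (Set.uIcc (0:ℝ) 1) :=
        (hgi.absolutelyContinuousOnInterval_intervalIntegral (c := 0) (by simp)).continuousOn
      have hEc : ContinuousOn (fun t => 2 * b ^ 2 * Real.exp (∫ s in (0:ℝ)..t, g s))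
        (Set.uIcc (0:ℝ) 1) := by fun_prop
      have hgz : IntervalIntegrable (fun t => (1 / 2) * (g t - ζ) ^ 2) volume 0 1 := by
        have := ((hg2'.const_mul (1/2)).sub (hgi.const_mul ζ)).add
          (intervalIntegrable_const (c := ζ ^ 2 / 2))
        refine this.congr (fun t _ => ?_)
        ring
      have hk : IntervalIntegrable (fun t => g t - p t) volume 0 1 := hgi.sub hpi
      have parts := JB_parts (fun t => p t - ζ) (fun t => 2 * b ^ 2 * Real.exp (h t))
        (fun t => g t - p t) (fun t ht => (hp t ht).sub_const ζ) (hu ▸ hec) (by simp [h1]) hk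
      rw [← intervalIntegral.integral_const_mul, ← intervalIntegral.integral_const_mul,
        ← intervalIntegral.integral_add hEc.intervalIntegrable hgz]
      have hKc : ContinuousOn (fun t => ∫ s in (0:ℝ)..t, (g s - p s)) (Set.uIcc (0:ℝ) 1) :=
        (hk.absolutelyContinuousOnInterval_intervalIntegral (c := 0) (by simp)).continuousOn
      have hB : IntervalIntegrable (fun t => 2 * b ^ 2 * Real.exp (h t) *
          (∫ s in (0:ℝ)..t, (g s - p s)) + (p t - ζ) * (g t - p t)) volume 0 1 := by
        refine (hec.mul hKc).intervalIntegrable.add ?_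
        exact hk.continuousOn_mul (f := fun t => g t - p t) (g := fun t => p t - ζ)
          (by fun_prop)
      have hA := hec.intervalIntegrable.add hqc.intervalIntegrable (μ := volume)
      have e : ∫ t in (0:ℝ)..1, (2 * b ^ 2 * Real.exp (h t) + (1 / 2) * (p t - ζ) ^ 2) =
        ∫ t in (0:ℝ)..1, ((2 * b ^ 2 * Real.exp (h t) + (1 / 2) * (p t - ζ) ^ 2) +
          (2 * b ^ 2 * Real.exp (h t) *
          (∫ s in (0:ℝ)..t, (g s - p s)) + (p t - ζ) * (g t - p t))) := by
        rw [intervalIntegral.integral_add hA hB, parts, add_zero]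
      rw [e]
      apply intervalIntegral.integral_mono_on zero_le_one (hA.add hB)
        (hEc.intervalIntegrable.add hgz)
      intro t ht
      have hsub : Set.uIcc 0 t ⊆ Set.uIcc (0:ℝ) 1 := by
        rw [Set.uIcc_of_le ht.1, hu]; exact Set.Icc_subset_Icc le_rfl ht.2
      have hK : ∫ s in (0:ℝ)..t, (g s - p s) = (∫ s in (0:ℝ)..t, g s) - h t := by
        rw [intervalIntegral.integral_sub (hgi.mono_set hsub) (hpi.mono_set hsub), hint t ht]
      rw [hK]
      set G := ∫ s in (0:ℝ)..t, g s
      have h3 : Real.exp (h t) * (1 + (G - h t)) ≤ Real.exp G := by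
        have : Real.exp G = Real.exp (h t) * Real.exp (G - h t) := by
          rw [← Real.exp_add]; congr 1; ring
        rw [this]
        gcongr
        linarith [Real.add_one_le_exp (G - h t)]
      have h4 := mul_le_mul_of_nonneg_left h3 (by positivity : 0 ≤ 2 * b ^ 2)
      nlinarith [sq_nonneg (g t - p t)]
  unfold JB
  exact hleast.csInf_eq

/-- Case ii) of Proposition 2: for `b ≥ ζ/(2+ζ)` and `ξ ∈ (0, π/2)` solving
`2ξ²(4ξ² + ζ²) = 2b²(2ξ cos ξ + ζ sin ξ)²`, the rate function is
`J_B(b,ζ) = −2b² R(b,ζ)` with `R` as below. -/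
theorem JB_formula_case_ii (b ζ ξ : ℝ) (hζ : 0 ≤ ζ) (hb : 0 < b)
    (hb' : ζ / (2 + ζ) ≤ b) (hξ : ξ ∈ Set.Ioo 0 (π / 2))
    (heq : 2 * ξ ^ 2 * (4 * ξ ^ 2 + ζ ^ 2) =
      2 * b ^ 2 * (2 * ξ * Real.cos ξ + ζ * Real.sin ξ) ^ 2) :
    JB b ζ = -2 * b ^ 2 *
      (1 - Real.sin ξ ^ 2 * (1 + ζ * (4 - ζ) / (4 * ξ ^ 2))
        + (ζ - 2) / (2 * ξ) * Real.sin (2 * ξ)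
        + (ζ / b ^ 2) * Real.log (Real.cos ξ + ζ * Real.sin ξ / (2 * ξ))
        - ζ ^ 2 / (2 * b ^ 2)) := by
  obtain ⟨hξ0, hξ1⟩ := hξ
  obtain ⟨θ, hθ⟩ : ∃ θ, θ = Real.arctan (ζ / (2 * ξ)) := ⟨_, rfl⟩
  have hθ0 : 0 ≤ θ := by rw [hθ]; exact Real.arctan_nonneg.2 (by positivity)
  have hθ1 : θ < π / 2 := by rw [hθ]; exact Real.arctan_lt_pi_div_two _
  have htan : Real.tan θ = ζ / (2 * ξ) := by rw [hθ, Real.tan_arctan]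
  have hcθ : 0 < Real.cos θ := Real.cos_pos_of_mem_Ioo ⟨by linarith, hθ1⟩
  have hcξ : 0 < Real.cos ξ := Real.cos_pos_of_mem_Ioo ⟨by linarith, hξ1⟩
  have hsξ : 0 < Real.sin ξ := Real.sin_pos_of_pos_of_lt_pi hξ0 (by linarith)
  have hsθ : Real.sin θ = ζ / (2 * ξ) * Real.cos θ := by
    rw [← htan, Real.tan_mul_cos hcθ.ne']
  have hpy : Real.cos θ ^ 2 * (4 * ξ ^ 2 + ζ ^ 2) = 4 * ξ ^ 2 := by
    have := Real.sin_sq_add_cos_sq θ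
    rw [hsθ] at this
    field_simp at this
    linarith
  obtain ⟨φ, hφ⟩ : ∃ φ, φ = θ - ξ := ⟨_, rfl⟩
  obtain ⟨D, hD⟩ : ∃ D, D = 2 * ξ * Real.cos ξ + ζ * Real.sin ξ := ⟨_, rfl⟩
  have hD0 : 0 < D := by rw [hD]; positivity
  have hcφ : Real.cos φ = Real.cos θ * D / (2 * ξ) := by
    rw [hφ, Real.cos_sub, hsθ, hD]; field_simp
  have hsφ : Real.sin φ = Real.cos θ * (ζ * Real.cos ξ - 2 * ξ * Real.sin ξ) / (2 * ξ) := by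
    rw [hφ, Real.sin_sub, hsθ]; field_simp
  have hcφ0 : 0 < Real.cos φ := by rw [hcφ]; positivity
  rw [← hD] at heq
  have hbφ : b ^ 2 * Real.cos φ ^ 2 = ξ ^ 2 := by
    rw [hcφ]
    have h1 : b ^ 2 * D ^ 2 = ξ ^ 2 * (4 * ξ ^ 2 + ζ ^ 2) := by linarith
    field_simp
    linear_combination Real.cos θ ^ 2 * h1 + ξ ^ 2 * hpy
  have hcos : ∀ t ∈ Set.Icc (0:ℝ) 1, 0 < Real.cos (ξ * t + φ) := by
    intro t ht
    apply Real.cos_pos_of_mem_Ioo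
    constructor <;> nlinarith [ht.1, ht.2, mul_nonneg hξ0.le ht.1,
      mul_nonneg hξ0.le (sub_nonneg.2 ht.2)]
  have hlin : ∀ t : ℝ, HasDerivAt (fun t => ξ * t + φ) ξ t := fun t => by
    simpa using ((hasDerivAt_id t).const_mul ξ).add_const φ
  obtain ⟨h, hh⟩ : ∃ h : ℝ → ℝ, h = fun t =>
    2 * Real.log (Real.cos φ) - 2 * Real.log (Real.cos (ξ * t + φ)) := ⟨_, rfl⟩
  obtain ⟨p, hp⟩ : ∃ p : ℝ → ℝ, p = fun t => 2 * ξ * Real.tan (ξ * t + φ) := ⟨_, rfl⟩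
  have hexp : ∀ t ∈ Set.Icc (0:ℝ) 1,
      2 * b ^ 2 * Real.exp (h t) = 2 * ξ ^ 2 / Real.cos (ξ * t + φ) ^ 2 := by
    intro t ht
    have hc := hcos t ht
    rw [hh]
    simp only
    rw [Real.exp_sub, two_mul (Real.log _), Real.exp_add, two_mul (Real.log _), Real.exp_add, Real.exp_log hcφ0,
      Real.exp_log hc, ← hbφ]
    field_simp
  have hh' : ∀ t ∈ Set.Icc (0:ℝ) 1, HasDerivAt h (p t) t := by
    intro t ht
    have hc := hcos t ht
    have := ((((hlin t).cos).log hc.ne').const_mul 2).const_sub (2 * Real.log (Real.cos φ))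
    rw [hh, hp]
    refine this.congr_deriv ?_
    simp only [Real.tan_eq_sin_div_cos]
    field_simp
  have hp' : ∀ t ∈ Set.Icc (0:ℝ) 1, HasDerivAt p (2 * b ^ 2 * Real.exp (h t)) t := by
    intro t ht
    have hc := hcos t ht
    have := ((Real.hasDerivAt_tan hc.ne').comp t (hlin t)).const_mul (2 * ξ)
    rw [hexp t ht, hp]
    refine this.congr_deriv ?_
    field_simp
  have hpm : Measurable p := by
    rw [hp]
    simp only [Real.tan_eq_sin_div_cos]
    fun_prop
  have h0 : h 0 = 0 := by rw [hh]; simp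
  have hu1 : ξ * 1 + φ = θ := by rw [hφ]; ring
  have h1 : p 1 = ζ := by
    rw [hp]; simp only [hu1, htan]; field_simp
  rw [JB_eq b ζ h p hpm hh' hp' h0 h1]
  have hder : ∀ t ∈ Set.uIcc (0:ℝ) 1, HasDerivAt
      (fun t => 2 * p t - 2 * ξ ^ 2 * t - ζ * h t + ζ ^ 2 / 2 * t)
      (2 * b ^ 2 * Real.exp (h t) + (1 / 2) * (p t - ζ) ^ 2) t := by
    intro t ht
    rw [Set.uIcc_of_le zero_le_one] at ht
    have hc := hcos t ht
    have := ((((hp' t ht).const_mul 2).sub ((hasDerivAt_id t).const_mul (2 * ξ ^ 2))).sub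
      ((hh' t ht).const_mul ζ)).add ((hasDerivAt_id t).const_mul (ζ ^ 2 / 2))
    refine this.congr_deriv ?_
    rw [hexp t ht, hp]
    simp only [Real.tan_eq_sin_div_cos]
    have hsc := Real.sin_sq_add_cos_sq (ξ * t + φ)
    have hs2 : Real.sin (ξ * t + φ) ^ 2 = 1 - Real.cos (ξ * t + φ) ^ 2 := by linarith
    field_simp
    ring_nf
    ring_nf at hs2
    rw [hs2]
    ring
  have hcont : ContinuousOn (fun t => 2 * b ^ 2 * Real.exp (h t) + (1 / 2) * (p t - ζ) ^ 2)
      (Set.uIcc (0:ℝ) 1) := by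
    rw [Set.uIcc_of_le zero_le_one]
    have hhc : ContinuousOn h (Set.Icc (0:ℝ) 1) := fun t ht =>
      (hh' t ht).continuousAt.continuousWithinAt
    have hpc : ContinuousOn p (Set.Icc (0:ℝ) 1) := fun t ht =>
      (hp' t ht).continuousAt.continuousWithinAt
    fun_prop
  rw [intervalIntegral.integral_eq_sub_of_hasDerivAt hder hcont.intervalIntegrable]
  have hp0 : p 0 = 2 * ξ * ((ζ * Real.cos ξ - 2 * ξ * Real.sin ξ) / D) := by
    rw [hp]
    simp only [mul_zero, zero_add]
    rw [Real.tan_eq_sin_div_cos, hsφ, hcφ]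
    field_simp
  have hh1 : h 1 = 2 * Real.log (Real.cos ξ + ζ * Real.sin ξ / (2 * ξ)) := by
    rw [hh]
    simp only [hu1]
    rw [← mul_sub, ← Real.log_div hcφ0.ne' hcθ.ne', hcφ, hD]
    congr 2
    field_simp
  rw [hp0, hh1, h1, h0, Real.sin_two_mul]
  generalize Real.log (Real.cos ξ + ζ * Real.sin ξ / (2 * ξ)) = L
  have hb2 : b ^ 2 = ξ ^ 2 * (4 * ξ ^ 2 + ζ ^ 2) / D ^ 2 := by
    field_simp; linarith
  have hc2 : Real.cos ξ ^ 2 = 1 - Real.sin ξ ^ 2 := by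
    linarith [Real.sin_sq_add_cos_sq ξ]
  have e1 : -2 * b ^ 2 *
      (1 - Real.sin ξ ^ 2 * (1 + ζ * (4 - ζ) / (4 * ξ ^ 2))
        + (ζ - 2) / (2 * ξ) * (2 * Real.sin ξ * Real.cos ξ)
        + (ζ / b ^ 2) * L - ζ ^ 2 / (2 * b ^ 2)) =
      -2 * (b ^ 2 * (D ^ 2 / 4 - Real.sin ξ * D) / ξ ^ 2) - 2 * ζ * L + ζ ^ 2 := by
    rw [hD]
    field_simp
    ring_nf
    rw [hc2]
    ring
  rw [e1, hb2]
  have e2 : ζ * Real.cos ξ - 2 * ξ * Real.sin ξ =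
      (ζ * D - (4 * ξ ^ 2 + ζ ^ 2) * Real.sin ξ) / (2 * ξ) := by
    rw [hD]; field_simp; ring
  rw [e2]
  field_simp
  ring
end

section
/- Let ζ ≥ 0 and x > 1 + ζ/2, and suppose δ > 0 satisfies sinh(δ)/δ + 2ζ sinh²(δ/2)/δ² = x. Then I_BS(x; ζ) = (1/2)(δ² − ζ²) · (1 − 2 tanh(δ/2)/(δ + ζ tanh(δ/2))) − 2ζ log(cosh(δ/2) + ζ sinh(δ/2)/δ) + ζ². -/
open MeasureTheory Real Filter
open scoped ENNReal

/-- The rate function `I_BS(x; ζ)`: the infimum, over measurable `g : [0,1] → ℝ`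
with `∫₀¹ g(t)² dt < ∞` and `∫₀¹ exp(∫₀ᵗ g(s) ds) dt = x`, of
`(1/2) ∫₀¹ (g(t) − ζ)² dt`, with the infimum over the empty set equal to `+∞`. -/
noncomputable def IBS (ζ x : ℝ) : ℝ≥0∞ :=
  sInf {y : ℝ≥0∞ | ∃ g : ℝ → ℝ, Measurable g ∧
    IntegrableOn (fun t => (g t) ^ 2) (Set.Icc 0 1) ∧
    (∫ t in (0:ℝ)..1, Real.exp (∫ s in (0:ℝ)..t, g s)) = x ∧
    y = ENNReal.ofReal ((1 / 2) * ∫ t in (0:ℝ)..1, (g t - ζ) ^ 2)}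

lemma ac_exp {f : ℝ → ℝ} {a b : ℝ} (hf : AbsolutelyContinuousOnInterval f a b) :
    AbsolutelyContinuousOnInterval (fun t => Real.exp (f t)) a b := by
  obtain ⟨C, hC⟩ := hf.exists_bound
  have hlip : ∀ u v : ℝ, u ≤ C → v ≤ C → |Real.exp u - Real.exp v| ≤ Real.exp C * |u - v| := by
    have key : ∀ u v : ℝ, u ≤ v → v ≤ C → Real.exp v - Real.exp u ≤ Real.exp C * (v - u) := by
      intro u v huv hv
      have h1 := Real.add_one_le_exp (u - v)
      have h2 : Real.exp u = Real.exp v * Real.exp (u - v) := by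
        rw [← Real.exp_add]; congr 1; ring
      have h3 := Real.exp_le_exp.2 hv
      have h4 := Real.exp_pos v
      nlinarith [mul_nonneg (sub_nonneg.2 h3) (sub_nonneg.2 huv)]
    intro u v hu hv
    rcases le_total u v with h | h
    · rw [abs_sub_comm, abs_sub_comm u v, abs_of_nonneg (sub_nonneg.2 (Real.exp_le_exp.2 h)),
        abs_of_nonneg (sub_nonneg.2 h)]
      exact key u v h hv
    · rw [abs_of_nonneg (sub_nonneg.2 (Real.exp_le_exp.2 h)), abs_of_nonneg (sub_nonneg.2 h)]
      exact key v u h hu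
  rw [absolutelyContinuousOnInterval_iff] at hf ⊢
  intro ε hε
  obtain ⟨d, hd, H⟩ := hf (ε / Real.exp C) (by positivity)
  refine ⟨d, hd, fun E hE hlen => ?_⟩
  have h1 := H E hE hlen
  rw [lt_div_iff₀ (Real.exp_pos C)] at h1
  refine lt_of_le_of_lt ?_ h1
  rw [Finset.sum_mul]
  refine Finset.sum_le_sum fun i hi => ?_
  have hm := hE.1 i hi
  rw [Real.dist_eq, Real.dist_eq, mul_comm]
  exact hlip _ _ ((le_abs_self _).trans (hC _ hm.1)) ((le_abs_self _).trans (hC _ hm.2))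

lemma lower_core (g : ℝ → ℝ) (hg : Integrable g)
    (hg2 : IntervalIntegrable (fun t => (g t) ^ 2) volume 0 1)
    (ζ x δ α β N : ℝ) (hζ : 0 ≤ ζ) (hδ : 0 < δ) (hN : 0 < N)
    (hx : (∫ t in (0:ℝ)..1, Real.exp (∫ s in (0:ℝ)..t, g s)) = x)
    (hα : 0 < 1 + α * x) (hβ : 0 < 1 + β * x) (hd : α - β = δ)
    (he : Real.exp δ * (1 + β * x) = 1 + α * x)
    (hm1 : α + β + 2 * α * β * x = ζ) (hNN : (1 + α * x) * (1 + β * x) = N ^ 2) :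
    ζ - (α + β) + δ ^ 2 / 2 - 2 * ζ * Real.log N + ζ ^ 2 / 2 ≤
      (1 / 2) * ∫ t in (0:ℝ)..1, (g t - ζ) ^ 2 := by
  set G : ℝ → ℝ := fun t => ∫ s in (0:ℝ)..t, g s with hG
  have hGc : Continuous G := intervalIntegral.continuous_primitive
    (fun a b => hg.intervalIntegrable) 0
  set e : ℝ → ℝ := fun t => Real.exp (G t) with he'
  have hec : Continuous e := Real.continuous_exp.comp hGc
  have hepos : ∀ t, 0 < e t := fun t => Real.exp_pos _
  set h : ℝ → ℝ := fun t => ∫ s in (0:ℝ)..t, e s with hh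
  have hhd : ∀ t, HasDerivAt h (e t) t := fun t => hec.integral_hasStrictDerivAt 0 t |>.hasDerivAt
  have hhdiff : ContDiff ℝ 1 h := by
    rw [contDiff_one_iff_deriv]
    refine ⟨fun t => (hhd t).differentiableAt, ?_⟩
    rw [show deriv h = e from funext fun t => (hhd t).deriv]
    exact hec
  have hh0 : h 0 = 0 := by simp [hh]
  have hh1 : h 1 = x := hx
  have hmono : StrictMono h := strictMono_of_deriv_pos (fun t => by
    rw [(hhd t).deriv]; exact hepos t)
  have hlin : ∀ c : ℝ, 0 < 1 + c * x → ∀ t ∈ Set.Icc (0:ℝ) 1, 0 < 1 + c * h t := by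
    intro c hc t ht
    have h0 : 0 ≤ h t := by rw [← hh0]; exact hmono.monotone ht.1
    have h1 : h t ≤ x := by rw [← hh1]; exact hmono.monotone ht.2
    rcases le_total 0 c with hc0 | hc0
    · have := mul_nonneg hc0 h0; linarith
    · nlinarith
  set a : ℝ → ℝ := fun t => 1 + α * h t with ha
  set b : ℝ → ℝ := fun t => 1 + β * h t with hb
  have hapos : ∀ t ∈ Set.Icc (0:ℝ) 1, 0 < a t := hlin α hα
  have hbpos : ∀ t ∈ Set.Icc (0:ℝ) 1, 0 < b t := hlin β hβ
  have hac : Continuous a := by have := hhdiff.continuous; fun_prop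
  have hbc : Continuous b := by have := hhdiff.continuous; fun_prop
  have had : ∀ t, HasDerivAt a (α * e t) t := fun t => ((hhd t).const_mul α).const_add 1
  have hbd : ∀ t, HasDerivAt b (β * e t) t := fun t => ((hhd t).const_mul β).const_add 1
  set m : ℝ → ℝ := fun t => α + β + 2 * α * β * h t with hm
  have hmc : Continuous m := by have := hhdiff.continuous; fun_prop
  have hmd : ∀ t, HasDerivAt m (2 * α * β * e t) t :=
    fun t => ((hhd t).const_mul (2 * α * β)).const_add (α + β)
  set φ : ℝ → ℝ := fun t => m t / (a t * b t) with hφ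
  set φ' : ℝ → ℝ := fun t => (2 * α * β * (a t * b t) - m t ^ 2) / (a t * b t) ^ 2 * e t with hφ'
  have habm : ∀ t, α * b t + β * a t = m t := by intro t; simp only [ha, hb, hm]; ring
  have hφd : ∀ t ∈ Set.Icc (0:ℝ) 1, HasDerivAt φ (φ' t) t := by
    intro t ht
    have h1 := (hapos t ht).ne'
    have h2 := (hbpos t ht).ne'
    have := (hmd t).div ((had t).mul (hbd t)) (mul_ne_zero h1 h2)
    refine this.congr_deriv ?_
    simp only [hφ', Pi.mul_apply, ← habm t]
    field_simp
  have hφ'c : ContinuousOn φ' (Set.Icc 0 1) := by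
    refine ContinuousOn.mul (ContinuousOn.div (by fun_prop) (by fun_prop) ?_) hec.continuousOn
    intro t ht
    exact pow_ne_zero _ (mul_pos (hapos t ht) (hbpos t ht)).ne'
  have hφc : ContinuousOn φ (Set.Icc 0 1) := fun t ht => (hφd t ht).continuousAt.continuousWithinAt
  have hu : Set.uIcc (0:ℝ) 1 = Set.Icc 0 1 := Set.uIcc_of_le zero_le_one
  have hφac : AbsolutelyContinuousOnInterval φ 0 1 := by
    apply ContDiffOn.absolutelyContinuousOnInterval
    rw [hu]
    refine ContDiffOn.div (by fun_prop) (by fun_prop) ?_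
    intro t ht
    exact (mul_pos (hapos t ht) (hbpos t ht)).ne'
  have hgi : IntervalIntegrable g volume 0 1 := hg.intervalIntegrable
  have hGac : AbsolutelyContinuousOnInterval G 0 1 :=
    hgi.absolutelyContinuousOnInterval_intervalIntegral (by simp)
  have heac : AbsolutelyContinuousOnInterval e 0 1 := ac_exp hGac
  have hG0 : G 0 = 0 := by simp [hG]
  -- integration by parts
  have hq : ∫ t in (0:ℝ)..1, (e t * φ t * g t + e t * φ' t) = e 1 * φ 1 - e 0 * φ 0 := by
    rw [← heac.integral_deriv_mul_eq_sub hφac]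
    apply intervalIntegral.integral_congr_ae
    filter_upwards [hgi.ae_hasDerivAt_integral] with t ht htt
    have htm : t ∈ Set.uIcc (0:ℝ) 1 := Set.uIoc_subset_uIcc htt
    have h1 : HasDerivAt G (g t) t := ht htm 0 (by simp)
    have h2 : HasDerivAt e (e t * g t) t := h1.exp
    rw [h2.deriv, (hφd t (hu ▸ htm)).deriv]
    ring
  set p : ℝ → ℝ := fun t => e t / (a t * b t) with hp
  have hpc : ContinuousOn p (Set.Icc 0 1) := by
    refine ContinuousOn.div (by fun_prop) (by fun_prop) ?_
    intro t ht
    exact (mul_pos (hapos t ht) (hbpos t ht)).ne'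
  have hpi : IntervalIntegrable p volume 0 1 := ContinuousOn.intervalIntegrable (hu ▸ hpc)
  have hpint : ∫ t in (0:ℝ)..1, p t = 1 := by
    have : ∫ t in (0:ℝ)..1, p t = (Real.log (a 1) - Real.log (b 1)) / δ
        - (Real.log (a 0) - Real.log (b 0)) / δ := by
      apply intervalIntegral.integral_eq_sub_of_hasDerivAt (f := fun t =>
        (Real.log (a t) - Real.log (b t)) / δ) _ hpi
      intro t ht
      rw [hu] at ht
      have h1 := (hapos t ht).ne'
      have h2 := (hbpos t ht).ne'
      have := (((had t).log h1).sub ((hbd t).log h2)).div_const δ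
      refine this.congr_deriv ?_
      simp only [hp]
      field_simp
      rw [← hd]
      simp only [ha, hb]
      ring
    rw [this]
    have e1 : a 1 = Real.exp δ * b 1 := by simp only [ha, hb, hh1, he]
    have hb1 : 0 < b 1 := hbpos 1 (by simp)
    rw [e1, Real.log_mul (Real.exp_pos _).ne' hb1.ne', Real.log_exp]
    simp only [ha, hb, hh0]
    simp [hδ.ne']
  have hqi : IntervalIntegrable (fun t => e t * φ t * g t + e t * φ' t) volume 0 1 := by
    refine IntervalIntegrable.add ?_ ?_
    · exact hgi.continuousOn_mul (hu ▸ hec.continuousOn.mul hφc)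
    · exact ContinuousOn.intervalIntegrable (hu ▸ hec.continuousOn.mul hφ'c)
  have hi2 : IntervalIntegrable (fun t => δ ^ 2 / 2 * (2 * p t - 1)) volume 0 1 :=
    ((hpi.const_mul 2).sub intervalIntegrable_const).const_mul _
  have hi3 : IntervalIntegrable (fun t => ζ ^ 2 / 2 - ζ * g t) volume 0 1 :=
    intervalIntegrable_const.sub (hgi.const_mul ζ)
  have hR : ∫ t in (0:ℝ)..1, ((e t * φ t * g t + e t * φ' t) + δ ^ 2 / 2 * (2 * p t - 1)
      + (ζ ^ 2 / 2 - ζ * g t)) = e 1 * φ 1 - e 0 * φ 0 + δ ^ 2 / 2 + (ζ ^ 2 / 2 - ζ * G 1) := by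
    rw [intervalIntegral.integral_add (hqi.add hi2) hi3, intervalIntegral.integral_add hqi hi2, hq,
      intervalIntegral.integral_const_mul, intervalIntegral.integral_sub (hpi.const_mul 2)
      intervalIntegrable_const, intervalIntegral.integral_const_mul, hpint,
      intervalIntegral.integral_sub intervalIntegrable_const (hgi.const_mul ζ),
      intervalIntegral.integral_const_mul]
    simp only [intervalIntegral.integral_const, hG]
    norm_num
  have hcost : IntervalIntegrable (fun t => (1 / 2) * (g t - ζ) ^ 2) volume 0 1 := by
    have : (fun t => (1 / 2) * (g t - ζ) ^ 2) = fun t => (1/2) * (g t) ^ 2 + (ζ ^ 2 / 2 - ζ * g t) := by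
      funext t; ring
    rw [this]
    exact (hg2.const_mul _).add hi3
  have hle : ∫ t in (0:ℝ)..1, ((e t * φ t * g t + e t * φ' t) + δ ^ 2 / 2 * (2 * p t - 1)
      + (ζ ^ 2 / 2 - ζ * g t)) ≤ ∫ t in (0:ℝ)..1, (1 / 2) * (g t - ζ) ^ 2 := by
    refine intervalIntegral.integral_mono_on zero_le_one ((hqi.add hi2).add hi3) hcost ?_
    intro t ht
    have h1 := (hapos t ht).ne'
    have h2 := (hbpos t ht).ne'
    have e1 : e t * φ t = p t * m t := by simp only [hφ, hp]; ring
    have e2 : e t * φ' t = p t ^ 2 * (2 * α * β * (a t * b t) - m t ^ 2) := by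
      simp only [hφ', hp]; field_simp
    have e3 : m t ^ 2 - 4 * α * β * (a t * b t) = δ ^ 2 := by
      rw [← hd]; simp only [hm, ha, hb]; ring
    rw [e1, e2]
    have e4 : 2 * α * β * (a t * b t) = (m t ^ 2 - δ ^ 2) / 2 := by linarith
    rw [e4]
    nlinarith [sq_nonneg (g t - p t * m t), mul_nonneg (sq_nonneg δ) (sq_nonneg (p t - 1))]
  rw [hR, intervalIntegral.integral_const_mul] at hle
  refine le_trans ?_ hle
  have f0 : e 0 * φ 0 = α + β := by simp [he', hφ, hG0, hm, ha, hb, hh0]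
  have f1 : e 1 * φ 1 = ζ * (e 1 / N ^ 2) := by
    simp only [hφ, hm, ha, hb, hh1, hm1, hNN]; ring
  have f2 : G 1 = Real.log (e 1 / N ^ 2) + 2 * Real.log N := by
    rw [Real.log_div (hepos 1).ne' (by positivity), Real.log_pow]
    simp [he']
  rw [f0, f1, f2]
  have f3 := Real.log_le_sub_one_of_pos (show 0 < e 1 / N ^ 2 from div_pos (hepos 1) (by positivity))
  nlinarith [mul_le_mul_of_nonneg_left f3 hζ]

lemma upper_core (ζ δ N : ℝ) (hζ : 0 ≤ ζ) (hδ : 0 < δ)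
    (hN : N = Real.cosh (δ / 2) + ζ / δ * Real.sinh (δ / 2)) :
    ∃ g : ℝ → ℝ, Measurable g ∧ IntegrableOn (fun t => (g t) ^ 2) (Set.Icc 0 1) ∧
      (∫ t in (0:ℝ)..1, Real.exp (∫ s in (0:ℝ)..t, g s)) = 2 / δ * Real.sinh (δ / 2) * N ∧
      (1 / 2) * ∫ t in (0:ℝ)..1, (g t - ζ) ^ 2 =
        ζ - δ * (Real.sinh (δ / 2) + ζ / δ * Real.cosh (δ / 2)) / N
          + δ ^ 2 / 2 - 2 * ζ * Real.log N + ζ ^ 2 / 2 := by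
  set w : ℝ → ℝ := fun t => δ / 2 * (1 - t) with hw
  have hwd : ∀ t, HasDerivAt w (-(δ / 2)) t := by
    intro t
    have := ((hasDerivAt_id t).const_sub 1).const_mul (δ / 2)
    exact this.congr_deriv (by ring)
  set D : ℝ → ℝ := fun t => Real.cosh (w t) + ζ / δ * Real.sinh (w t) with hD
  set S : ℝ → ℝ := fun t => Real.sinh (w t) + ζ / δ * Real.cosh (w t) with hS
  have hwc : Continuous w := by fun_prop
  have hDc : Continuous D := (Real.continuous_cosh.comp hwc).add
    ((Real.continuous_sinh.comp hwc).const_mul _)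
  have hSc : Continuous S := (Real.continuous_sinh.comp hwc).add
    ((Real.continuous_cosh.comp hwc).const_mul _)
  have hDd : ∀ t, HasDerivAt D (-(δ / 2) * S t) t := by
    intro t
    exact ((hwd t).cosh.add ((hwd t).sinh.const_mul (ζ / δ))).congr_deriv (by simp only [hS]; ring)
  have hSd : ∀ t, HasDerivAt S (-(δ / 2) * D t) t := by
    intro t
    exact ((hwd t).sinh.add ((hwd t).cosh.const_mul (ζ / δ))).congr_deriv (by simp only [hD]; ring)
  have hDpos : ∀ t ∈ Set.Icc (0:ℝ) 1, 0 < D t := by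
    intro t ht
    have h1 : 0 ≤ w t := mul_nonneg (by positivity) (by linarith [ht.2])
    have h2 : 0 ≤ ζ / δ * Real.sinh (w t) :=
      mul_nonneg (div_nonneg hζ hδ.le) (Real.sinh_nonneg_iff.2 h1)
    have h3 := Real.cosh_pos (w t)
    simp only [hD]; linarith
  have hD0 : D 0 = N := by simp [hD, hw, hN]
  have hD1 : D 1 = 1 := by simp [hD, hw]
  have hS1 : S 1 = ζ / δ := by simp [hS, hw]
  have hS0 : S 0 = Real.sinh (δ / 2) + ζ / δ * Real.cosh (δ / 2) := by simp [hS, hw]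
  have hNpos : 0 < N := hD0 ▸ hDpos 0 (by simp)
  have hu : Set.uIcc (0:ℝ) 1 = Set.Icc 0 1 := Set.uIcc_of_le zero_le_one
  set g : ℝ → ℝ := fun t => δ * S t / D t with hg
  have hgc : ContinuousOn g (Set.Icc 0 1) :=
    ContinuousOn.div (by fun_prop) (by fun_prop) fun t ht => (hDpos t ht).ne'
  have hLd : ∀ t ∈ Set.Icc (0:ℝ) 1, HasDerivAt (fun t => -2 * Real.log (D t)) (g t) t := by
    intro t ht
    exact (((hDd t).log (hDpos t ht).ne').const_mul (-2)).congr_deriv (by simp only [hg]; ring)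
  have hG : ∀ t ∈ Set.Icc (0:ℝ) 1, ∫ s in (0:ℝ)..t, g s = 2 * Real.log N - 2 * Real.log (D t) := by
    intro t ht
    have hsub : Set.uIcc 0 t ⊆ Set.Icc (0:ℝ) 1 := by
      rw [Set.uIcc_of_le ht.1]; exact Set.Icc_subset_Icc_right ht.2
    rw [intervalIntegral.integral_eq_sub_of_hasDerivAt (fun s hs => hLd s (hsub hs))
      (ContinuousOn.intervalIntegrable (hgc.mono hsub)), hD0]
    ring
  refine ⟨g, (hSc.measurable.const_mul δ).div hDc.measurable,
    (hgc.pow 2).integrableOn_compact isCompact_Icc, ?_, ?_⟩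
  · have h1 : ∫ t in (0:ℝ)..1, Real.exp (∫ s in (0:ℝ)..t, g s) =
        ∫ t in (0:ℝ)..1, N ^ 2 / D t ^ 2 := by
      apply intervalIntegral.integral_congr
      intro t ht
      rw [hu] at ht
      have hDp := hDpos t ht
      simp only []
      rw [hG t ht, Real.exp_sub, two_mul, two_mul, Real.exp_add, Real.exp_add, Real.exp_log hNpos,
        Real.exp_log hDp, sq, sq]
    rw [h1]
    have hcont : ContinuousOn (fun t => N ^ 2 / D t ^ 2) (Set.Icc 0 1) :=
      ContinuousOn.div (by fun_prop) (by fun_prop) fun t ht => pow_ne_zero _ (hDpos t ht).ne'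
    rw [intervalIntegral.integral_eq_sub_of_hasDerivAt
      (f := fun t => -(2 / δ) * N ^ 2 * (Real.sinh (w t) / D t)) ?_
      (ContinuousOn.intervalIntegrable (hu ▸ hcont))]
    · have e0 : w 0 = δ / 2 := by simp [hw]
      have e1 : w 1 = 0 := by simp [hw]
      rw [hD0, e0, e1, Real.sinh_zero]
      field_simp
      ring
    · intro t ht
      rw [hu] at ht
      have hDp := (hDpos t ht).ne'
      refine (((hwd t).sinh.div (hDd t) hDp).const_mul (-(2 / δ) * N ^ 2)).congr_deriv ?_
      have hid : Real.cosh (w t) * D t - Real.sinh (w t) * S t = 1 := by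
        simp only [hD, hS]
        linear_combination Real.cosh_sq_sub_sinh_sq (w t)
      have : Real.cosh (w t) * -(δ / 2) * D t - Real.sinh (w t) * (-(δ / 2) * S t) = -(δ / 2) := by
        linear_combination (-(δ / 2)) * hid
      rw [this]
      field_simp
  · rw [← intervalIntegral.integral_const_mul]
    have hcont : ContinuousOn (fun t => (1 / 2) * (g t - ζ) ^ 2) (Set.Icc 0 1) := by fun_prop
    rw [intervalIntegral.integral_eq_sub_of_hasDerivAt
      (f := fun t => g t + (δ ^ 2 / 2 + ζ ^ 2 / 2) * t - ζ * (-2 * Real.log (D t))) ?_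
      (ContinuousOn.intervalIntegrable (hu ▸ hcont))]
    · simp only [hg]
      rw [hD0, hD1, hS1, hS0, Real.log_one]
      field_simp
      ring
    · intro t ht
      rw [hu] at ht
      have hDp := (hDpos t ht).ne'
      have h1 := (((hSd t).const_mul δ).div (hDd t) hDp)
      refine ((h1.add ((hasDerivAt_id t).const_mul (δ ^ 2 / 2 + ζ ^ 2 / 2))).sub
        ((hLd t ht).const_mul ζ)).congr_deriv ?_
      simp only [hg]
      field_simp
      ring

/-- Case i) of the explicit rate function: for `x ≥ 1 + ζ/2` (here `x > 1 + ζ/2`)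
and `δ > 0` solving `sinh(δ)/δ + 2ζ sinh²(δ/2)/δ² = x`, one has the stated
closed form for `I_BS(x; ζ)`. -/
theorem IBS_formula_case_i (ζ x δ : ℝ) (hζ : 0 ≤ ζ) (hx : 1 + ζ / 2 < x)
    (hδ : 0 < δ)
    (heq : Real.sinh δ / δ + 2 * ζ * Real.sinh (δ / 2) ^ 2 / δ ^ 2 = x) :
    IBS ζ x = ENNReal.ofReal
      ((1 / 2) * (δ ^ 2 - ζ ^ 2) *
          (1 - 2 * Real.tanh (δ / 2) / (δ + ζ * Real.tanh (δ / 2)))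
        - 2 * ζ * Real.log (Real.cosh (δ / 2) + ζ * Real.sinh (δ / 2) / δ)
        + ζ ^ 2) := by
  set N : ℝ := Real.cosh (δ / 2) + ζ / δ * Real.sinh (δ / 2) with hN
  set C := Real.cosh (δ / 2) with hC
  set S := Real.sinh (δ / 2) with hS
  have hCpos : 0 < C := Real.cosh_pos _
  have hSpos : 0 < S := Real.sinh_pos_iff.2 (by positivity)
  have hCS : C ^ 2 - S ^ 2 = 1 := Real.cosh_sq_sub_sinh_sq _
  have hNpos : 0 < N := by positivity
  have hN' : C + ζ * S / δ = N := by rw [hN]; ring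
  have hNδ : N * δ = C * δ + ζ * S := by rw [hN]; field_simp
  have hxN : 2 / δ * S * N = x := by
    rw [← heq, hN]
    have : Real.sinh δ = 2 * S * C := by
      rw [hS, hC, ← Real.sinh_two_mul]; congr 1; ring
    rw [this]; field_simp
  have hval : (1 / 2) * (δ ^ 2 - ζ ^ 2) *
          (1 - 2 * Real.tanh (δ / 2) / (δ + ζ * Real.tanh (δ / 2)))
        - 2 * ζ * Real.log (C + ζ * S / δ) + ζ ^ 2 =
      ζ - δ * (S + ζ / δ * C) / N + δ ^ 2 / 2 - 2 * ζ * Real.log N + ζ ^ 2 / 2 := by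
    rw [hN', Real.tanh_eq_sinh_div_cosh, ← hC, ← hS]
    have h1 : δ + ζ * (S / C) = N * δ / C := by rw [hNδ]; field_simp
    have h2 : N = (C * δ + ζ * S) / δ := by rw [← hNδ]; field_simp
    have h3 : 0 < C * δ + ζ * S := by positivity
    rw [h1]
    suffices (1 / 2) * (δ ^ 2 - ζ ^ 2) * (1 - 2 * (S / C) / (N * δ / C)) + ζ ^ 2 =
      ζ - δ * (S + ζ / δ * C) / N + δ ^ 2 / 2 + ζ ^ 2 / 2 by linarith
    rw [h2]
    field_simp
    ring
  rw [hval]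
  apply le_antisymm
  · obtain ⟨g, hgm, hgi, hgx, hgc⟩ := upper_core ζ δ N hζ hδ hN
    apply sInf_le
    exact ⟨g, hgm, hgi, hgx.trans hxN, by rw [hgc]⟩
  · apply le_sInf
    rintro y ⟨g, hgm, hgi, hgx, rfl⟩
    apply ENNReal.ofReal_le_ofReal
    set g1 : ℝ → ℝ := (Set.Icc (0:ℝ) 1).indicator g with hg1
    have hgL : IntegrableOn g (Set.Icc 0 1) := by
      have : MemLp g 2 (volume.restrict (Set.Icc (0:ℝ) 1)) :=
        (memLp_two_iff_integrable_sq hgm.aestronglyMeasurable).2 hgi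
      exact this.integrable (by norm_num)
    have hg1i : Integrable g1 := (integrable_indicator_iff measurableSet_Icc).2 hgL
    have hu : Set.uIcc (0:ℝ) 1 = Set.Icc 0 1 := Set.uIcc_of_le zero_le_one
    have heqg : ∀ t ∈ Set.Icc (0:ℝ) 1, g1 t = g t := fun t ht => Set.indicator_of_mem ht g
    have hg2 : IntervalIntegrable (fun t => (g1 t) ^ 2) volume 0 1 := by
      rw [intervalIntegrable_iff_integrableOn_Icc_of_le zero_le_one]
      exact hgi.congr_fun (fun t ht => by simp only [heqg t ht]) measurableSet_Icc
    have hcosteq : ∫ t in (0:ℝ)..1, (g t - ζ) ^ 2 = ∫ t in (0:ℝ)..1, (g1 t - ζ) ^ 2 := by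
      apply intervalIntegral.integral_congr
      intro t ht
      rw [hu] at ht
      simp only [heqg t ht]
    have hxeq : (∫ t in (0:ℝ)..1, Real.exp (∫ s in (0:ℝ)..t, g1 s)) = x := by
      rw [← hgx]
      apply intervalIntegral.integral_congr
      intro t ht
      rw [hu] at ht
      simp only []
      congr 1
      apply intervalIntegral.integral_congr
      intro s hs
      rw [Set.uIcc_of_le ht.1] at hs
      exact heqg s ⟨hs.1, hs.2.trans ht.2⟩
    rw [hcosteq]
    have hE : Real.exp (δ / 2) = C + S := (Real.cosh_add_sinh _).symm
    have hE2 : Real.exp δ = (C + S) ^ 2 := by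
      rw [← hE, sq, ← Real.exp_add]; congr 1; ring
    set α := (δ + ζ) * (C + S) / (2 * N) with hα
    set β := (ζ - δ) * (C - S) / (2 * N) with hβ
    have hαx : 1 + α * x = (C + S) * N := by
      rw [hα, ← hxN, hN]; field_simp
      linear_combination (-δ) * hCS
    have hβx : 1 + β * x = (C - S) * N := by
      rw [hβ, ← hxN, hN]; field_simp
      linear_combination (-δ) * hCS
    have hCmS : 0 < C - S := by
      have : (C - S) * (C + S) = 1 := by linear_combination hCS
      have h2 : 0 < C + S := by positivity
      by_contra hcon
      nlinarith
    have hαβ : α + β = δ * (S + ζ / δ * C) / N := by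
      rw [hα, hβ]; field_simp; ring
    rw [← hαβ]
    refine lower_core g1 hg1i hg2 ζ x δ α β N hζ hδ hNpos hxeq ?_ ?_ ?_ ?_ ?_ ?_
    · rw [hαx]; positivity
    · rw [hβx]; positivity
    · rw [hα, hβ]; field_simp
      linear_combination (-2) * hNδ
    · rw [hE2, hαx, hβx]
      linear_combination (C + S) * N * hCS
    · have : α + β + 2 * α * β * x = α * (1 + β * x) + β * (1 + α * x) := by ring
      rw [this, hαx, hβx, hα, hβ]; field_simp
      linear_combination (2 * ζ) * hCS
    · rw [hαx, hβx]; linear_combination N ^ 2 * hCS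
end
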